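/- arXiv:0806.0939 — 15 statements merged into one kernel-verified Lean document; each statement's English description precedes it below -/
import Mathlib

section
/- Let C be a doubly even binary linear code, φ a factor set on C, and L(φ) the associated code loop with multiplication ∗. The identity (x∗x)∗(y∗z) = (x∗(x∗y))∗z holds for all x, y, z ∈ L(φ) if and only if φ(u, u+v) + φ(u,v) + φ(u,u) = 0 for all u, v ∈ C. -/
/-- Number of nonzero coordinates of `u` (the Hamming weight `‖u‖`). -/
def wt {n : ℕ} (u : Fin n → ZMod 2) : ℕ :=
  (Finset.univ.filter fun i => u i ≠ 0).card

/-- Number of coordinates at which both `u` and `v` are nonzero (`u·v`). -/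
def dotc {n : ℕ} (u v : Fin n → ZMod 2) : ℕ :=
  (Finset.univ.filter fun i => u i ≠ 0 ∧ v i ≠ 0).card

/-- Number of coordinates at which `u`, `v` and `w` are all nonzero (`c(u,v,w)`). -/
def tric {n : ℕ} (u v w : Fin n → ZMod 2) : ℕ :=
  (Finset.univ.filter fun i => u i ≠ 0 ∧ v i ≠ 0 ∧ w i ≠ 0).card

/-- A binary linear code is doubly even if `4 ∣ ‖u‖` and `u·v` is even, for all `u, v ∈ C`. -/
def DoublyEven {n : ℕ} (C : Submodule (ZMod 2) (Fin n → ZMod 2)) : Prop :=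
  ∀ u v : C, 4 ∣ wt (u : Fin n → ZMod 2) ∧
    2 ∣ dotc (u : Fin n → ZMod 2) (v : Fin n → ZMod 2)

/-- `φ` is a factor set on the code `C`. -/
def IsFactorSet {n : ℕ} (C : Submodule (ZMod 2) (Fin n → ZMod 2))
    (φ : C → C → ZMod 2) : Prop :=
  (∀ u : C, φ u u = ((wt (u : Fin n → ZMod 2) / 4 : ℕ) : ZMod 2)) ∧
  (∀ u v : C, φ u v + φ v u =
    ((dotc (u : Fin n → ZMod 2) (v : Fin n → ZMod 2) / 2 : ℕ) : ZMod 2)) ∧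
  (∀ u v w : C, φ u v + φ (u + v) w + φ v w + φ u (v + w) =
    ((tric (u : Fin n → ZMod 2) (v : Fin n → ZMod 2) (w : Fin n → ZMod 2) : ℕ) : ZMod 2))

/-- `φ` is left weakly linear. -/
def LWL {n : ℕ} {C : Submodule (ZMod 2) (Fin n → ZMod 2)} (φ : C → C → ZMod 2) : Prop :=
  ∀ u v : C, φ (u + v) u = φ u u + φ v u

/-- `φ` is right weakly linear. -/
def RWL {n : ℕ} {C : Submodule (ZMod 2) (Fin n → ZMod 2)} (φ : C → C → ZMod 2) : Prop :=
  ∀ u v : C, φ u (u + v) = φ u u + φ u v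

/-- The multiplication of the code loop `L(φ) = F₂ × C`:
`(a,u) ∗ (b,v) = (a + b + φ(u,v), u + v)`. -/
def cmul {n : ℕ} {C : Submodule (ZMod 2) (Fin n → ZMod 2)} (φ : C → C → ZMod 2)
    (x y : ZMod 2 × C) : ZMod 2 × C :=
  (x.1 + y.1 + φ x.2 y.2, x.2 + y.2)

theorem stmt4 {n : ℕ} (C : Submodule (ZMod 2) (Fin n → ZMod 2))
    (φ : C → C → ZMod 2) (hC : DoublyEven C) (hφ : IsFactorSet C φ) :
    (∀ x y z : ZMod 2 × C,
      cmul φ (cmul φ x x) (cmul φ y z) = cmul φ (cmul φ x (cmul φ x y)) z) ↔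
    (∀ u v : C, φ u (u + v) + φ u v + φ u u = 0) := by
  obtain ⟨h1, h2, h3⟩ := hφ
  have huu : ∀ u : C, u + u = 0 := by
    intro u
    ext i
    exact CharTwo.add_self_eq_zero _
  have huv : ∀ u v : C, u + (u + v) = v := by
    intro u v
    rw [← add_assoc, huu, zero_add]
  have h00 : φ 0 0 = 0 := by
    rw [h1]
    simp [wt]
  have h0 : ∀ w : C, φ 0 w = 0 := by
    intro w
    have h := h3 0 0 w
    simp only [zero_add, h00, tric, Submodule.coe_zero, Pi.zero_apply, ne_eq, not_true_eq_false,
      false_and, Finset.filter_false, Finset.card_empty, Nat.cast_zero] at h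
    rwa [CharTwo.add_self_eq_zero, zero_add] at h
  have key : ∀ a b c p q r s : ZMod 2,
      (a + a + p + (b + c + q) + 0 = a + (a + b + r) + s + c + q) ↔ s + r + p = 0 := by
    decide
  constructor
  · intro h u v
    have h := congrArg Prod.fst (h (0, u) (0, v) (0, 0))
    simp only [cmul, huu, huv, h0] at h
    exact (key _ _ _ _ _ _ _).1 h
  · rintro h ⟨a, u⟩ ⟨b, v⟩ ⟨c, w⟩
    simp only [cmul, huu, huv, h0]
    refine Prod.ext ?_ ?_
    · exact (key _ _ _ _ _ _ _).2 (h u v)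
    · exact zero_add _
end

section
/- Let C be a doubly even binary linear code, φ a factor set on C, and L(φ) the associated code loop with multiplication ∗. The identity ((x∗x)∗y)∗z = x∗(x∗(y∗z)) holds for all x, y, z ∈ L(φ) if and only if φ(u,u) + φ(u, v+w) + φ(u, u+v+w) = 0 for all u, v, w ∈ C. -/
theorem stmt6 {n : ℕ} (C : Submodule (ZMod 2) (Fin n → ZMod 2))
    (φ : C → C → ZMod 2) (hC : DoublyEven C) (hφ : IsFactorSet C φ) :
    (∀ x y z : ZMod 2 × C,
      cmul φ (cmul φ (cmul φ x x) y) z = cmul φ x (cmul φ x (cmul φ y z))) ↔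
    (∀ u v w : C, φ u u + φ u (v + w) + φ u (u + v + w) = 0) := by
  obtain ⟨h1, -, h3⟩ := hφ
  have h00 : φ 0 0 = 0 := by
    rw [h1]; simp [wt]
  have h0 : ∀ w : C, φ 0 w = 0 := by
    intro w
    have h := h3 0 0 w
    have ht : tric ((0 : C) : Fin n → ZMod 2) ((0 : C) : Fin n → ZMod 2)
        (w : Fin n → ZMod 2) = 0 := by simp [tric]
    rw [ht, add_zero, zero_add, h00, zero_add, CharTwo.add_self_eq_zero, zero_add] at h
    simpa using h
  have hs : ∀ u : C, u + u = 0 := by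
    intro u
    ext i
    simp [CharTwo.add_self_eq_zero]
  have two : ∀ a : ZMod 2, a + a = 0 := CharTwo.add_self_eq_zero
  have key : ∀ a b c p q r s : ZMod 2,
      (a + a + p + b + 0 + c + q = a + (a + (b + c + q) + r) + s) ↔ p + r + s = 0 := by
    decide
  have main : ∀ (a b c : ZMod 2) (u v w : C),
      cmul φ (cmul φ (cmul φ (a, u) (a, u)) (b, v)) (c, w) =
        cmul φ (a, u) (cmul φ (a, u) (cmul φ (b, v) (c, w))) ↔
      φ u u + φ u (v + w) + φ u (u + v + w) = 0 := by
    intro a b c u v w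
    have e : u + (u + (v + w)) = v + w := by rw [← add_assoc, hs, zero_add]
    simp only [cmul, hs, zero_add, h0, e, Prod.mk.injEq, and_true]
    rw [add_assoc u v w, ← key a b c (φ u u) (φ v w), two a, zero_add]
  constructor
  · intro h u v w
    exact (main 0 0 0 u v w).1 (h _ _ _)
  · rintro h ⟨a, u⟩ ⟨b, v⟩ ⟨c, w⟩
    exact (main a b c u v w).2 (h u v w)
end

section
/- Let C be a doubly even binary linear code, φ a factor set on C, and L(φ) the associated code loop with multiplication ∗. The left central (LC) identity (x∗x)∗(y∗z) = (x∗(x∗y))∗z holds for all x, y, z ∈ L(φ) if and only if φ is right weakly linear. -/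
theorem stmt7 {n : ℕ} (C : Submodule (ZMod 2) (Fin n → ZMod 2))
    (φ : C → C → ZMod 2) (hC : DoublyEven C) (hφ : IsFactorSet C φ) :
    (∀ x y z : ZMod 2 × C,
      cmul φ (cmul φ x x) (cmul φ y z) = cmul φ (cmul φ x (cmul φ x y)) z) ↔ RWL φ := by
  obtain ⟨h1, -, h3⟩ := hφ
  have h00 : φ 0 0 = 0 := by
    rw [h1]
    simp [wt]
  have h0 : ∀ w, φ 0 w = 0 := by
    intro w
    have h := h3 0 0 w
    simp only [zero_add, h00] at h
    have ht : tric ((0 : C) : Fin n → ZMod 2) ((0 : C) : Fin n → ZMod 2) (w : Fin n → ZMod 2) = 0 := by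
      simp [tric]
    rw [ht] at h
    generalize φ 0 w = a at h
    revert h
    revert a
    decide
  have huu : ∀ u : C, u + u = 0 := by
    intro u
    ext i
    exact CharTwo.add_self_eq_zero _
  have key : ∀ a b c p q r s : ZMod 2,
      (a + a + p + (b + c + q) + 0 = a + (a + b + r) + s + c + q) ↔ s = p + r := by
    decide
  have main : ∀ x y z : ZMod 2 × C,
      cmul φ (cmul φ x x) (cmul φ y z) = cmul φ (cmul φ x (cmul φ x y)) z ↔
        φ x.2 (x.2 + y.2) = φ x.2 x.2 + φ x.2 y.2 := by
    intro x y z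
    have hv : x.2 + (x.2 + y.2) = y.2 := by
      rw [← add_assoc, huu, zero_add]
    simp only [cmul, huu, h0, hv, Prod.mk.injEq, zero_add, and_true]
    exact key _ _ _ _ _ _ _
  constructor
  · intro h u v
    exact (main (0, u) (0, v) (0, 0)).1 (h _ _ _)
  · intro h x y z
    exact (main x y z).2 (h _ _)
end

section
/- Let C be a doubly even binary linear code, φ a factor set on C, and L(φ) the associated code loop with multiplication ∗. The identity (y∗z)∗(x∗x) = y∗((z∗x)∗x) holds for all x, y, z ∈ L(φ) if and only if φ(u,u) + φ(w,u) + φ(w+u, u) = 0 for all u, w ∈ C. -/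
theorem stmt8 {n : ℕ} (C : Submodule (ZMod 2) (Fin n → ZMod 2))
    (φ : C → C → ZMod 2) (hC : DoublyEven C) (hφ : IsFactorSet C φ) :
    (∀ x y z : ZMod 2 × C,
      cmul φ (cmul φ y z) (cmul φ x x) = cmul φ y (cmul φ (cmul φ z x) x)) ↔
    (∀ u w : C, φ u u + φ w u + φ (w + u) u = 0) := by
  obtain ⟨h1, -, h3⟩ := hφ
  have two : ∀ a : ZMod 2, a + a = 0 := fun a => CharTwo.add_self_eq_zero a
  have twoC : ∀ u : C, u + u = 0 := by
    intro u
    ext i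
    simpa using two _
  have h00 : φ 0 0 = 0 := by
    rw [h1]
    simp [wt]
  have h0 : ∀ u : C, φ u 0 = 0 := by
    intro u
    have h := h3 u 0 0
    simp only [add_zero, h00, two, zero_add] at h
    rw [h]
    simp [tric]
  have key : ∀ a b c p q r s : ZMod 2,
      b + c + p + (a + a + q) + 0 = b + (c + a + r + a + s) + p ↔ q + r + s = 0 := by
    decide
  have main : ∀ x y z : ZMod 2 × C,
      cmul φ (cmul φ y z) (cmul φ x x) = cmul φ y (cmul φ (cmul φ z x) x) ↔
      φ x.2 x.2 + φ z.2 x.2 + φ (z.2 + x.2) x.2 = 0 := by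
    rintro ⟨a, u⟩ ⟨b, v⟩ ⟨c, w⟩
    simp only [cmul, Prod.mk.injEq, add_assoc w u u, twoC, add_zero, h0, and_true]
    simpa using key a b c (φ v w) (φ u u) (φ w u) (φ (w + u) u)
  constructor
  · intro h u w
    exact (main (0, u) (0, 0) (0, w)).1 (h _ _ _)
  · intro h x y z
    exact (main x y z).2 (h _ _)
end

section
/- Let C be a doubly even binary linear code, φ a factor set on C, and L(φ) the associated code loop with multiplication ∗. The identity ((y∗z)∗x)∗x = y∗((z∗x)∗x) holds for all x, y, z ∈ L(φ) if and only if φ(w,u) + φ(w+u, u) + φ(v+w, u) + φ(v+w+u, u) = 0 for all u, v, w ∈ C. -/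
theorem stmt9 {n : ℕ} (C : Submodule (ZMod 2) (Fin n → ZMod 2))
    (φ : C → C → ZMod 2) (hC : DoublyEven C) (hφ : IsFactorSet C φ) :
    (∀ x y z : ZMod 2 × C,
      cmul φ (cmul φ (cmul φ y z) x) x = cmul φ y (cmul φ (cmul φ z x) x)) ↔
    (∀ u v w : C, φ w u + φ (w + u) u + φ (v + w) u + φ (v + w + u) u = 0) := by
  have huu : ∀ u : C, u + u = 0 := by
    intro u
    ext i
    exact CharTwo.add_self_eq_zero _
  have key : ∀ (a b c p q r s t : ZMod 2),
      (b + c + t + a + r + a + s = b + (c + a + p + a + q) + t) ↔ p + q + r + s = 0 := by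
    decide
  have main : ∀ x y z : ZMod 2 × C,
      (cmul φ (cmul φ (cmul φ y z) x) x = cmul φ y (cmul φ (cmul φ z x) x)) ↔
      φ z.2 x.2 + φ (z.2 + x.2) x.2 + φ (y.2 + z.2) x.2 + φ (y.2 + z.2 + x.2) x.2 = 0 := by
    intro x y z
    have h1 : z.2 + x.2 + x.2 = z.2 := by rw [add_assoc, huu, add_zero]
    have h2 : y.2 + z.2 + x.2 + x.2 = y.2 + z.2 := by rw [add_assoc, huu, add_zero]
    simp only [cmul, Prod.mk.injEq, h1, h2, and_true]
    exact key _ _ _ _ _ _ _ _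
  constructor
  · intro h u v w
    exact (main (0, u) (0, v) (0, w)).1 (h _ _ _)
  · intro h x y z
    exact (main x y z).2 (h _ _ _)
end

section
/- Let C be a doubly even binary linear code, φ a factor set on C, and L(φ) the associated code loop with multiplication ∗. The identity ((y∗z)∗x)∗x = y∗(z∗(x∗x)) holds for all x, y, z ∈ L(φ) if and only if φ(u,u) + φ(v+w, u) + φ(v+w+u, u) = 0 for all u, v, w ∈ C. -/
theorem stmt10 {n : ℕ} (C : Submodule (ZMod 2) (Fin n → ZMod 2))
    (φ : C → C → ZMod 2) (hC : DoublyEven C) (hφ : IsFactorSet C φ) :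
    (∀ x y z : ZMod 2 × C,
      cmul φ (cmul φ (cmul φ y z) x) x = cmul φ y (cmul φ z (cmul φ x x))) ↔
    (∀ u v w : C, φ u u + φ (v + w) u + φ (v + w + u) u = 0) := by
  obtain ⟨h1, -, h3⟩ := hφ
  have h00 : φ 0 0 = 0 := by
    rw [h1]; simp [wt]
  have h0 : ∀ u : C, φ u 0 = 0 := by
    intro u
    have h := h3 u 0 0
    have ht : tric (u : Fin n → ZMod 2) ((0 : C) : Fin n → ZMod 2)
        ((0 : C) : Fin n → ZMod 2) = 0 := by simp [tric]
    rw [ht, add_zero, add_zero, h00, add_zero, CharTwo.add_self_eq_zero, zero_add] at h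
    simpa using h
  have hs : ∀ u : C, u + u = 0 := by
    intro u
    ext i
    exact CharTwo.add_self_eq_zero _
  have key : ∀ a b c p q r s : ZMod 2,
      b + c + p + a + q + a + r = b + (c + (a + a + s) + 0) + p ↔ s + q + r = 0 := by
    decide
  constructor
  · intro h u v w
    have e := congrArg Prod.fst (h (0, u) (0, v) (0, w))
    simp only [cmul, hs, h0, add_zero w] at e
    exact (key _ _ _ _ _ _ _).1 e
  · rintro h ⟨a, u⟩ ⟨b, v⟩ ⟨c, w⟩
    refine Prod.ext ?_ ?_
    · simp only [cmul, hs, h0, add_zero w]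
      exact (key _ _ _ _ _ _ _).2 (h u v w)
    · simp only [cmul, add_assoc]
end

section
/- Let C be a doubly even binary linear code, φ a factor set on C, and L(φ) the associated code loop with multiplication ∗. The right central (RC) identity (y∗z)∗(x∗x) = y∗((z∗x)∗x) holds for all x, y, z ∈ L(φ) if and only if φ is left weakly linear. -/
theorem z2_add_self (a : ZMod 2) : a + a = 0 := CharTwo.add_self_eq_zero a

theorem factor_zero_right {n : ℕ} (C : Submodule (ZMod 2) (Fin n → ZMod 2))
    (φ : C → C → ZMod 2) (hφ : IsFactorSet C φ) (u : C) : φ u 0 = 0 := by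
  obtain ⟨h1, -, h3⟩ := hφ
  have h0 : φ 0 0 = 0 := by
    rw [h1 0]
    simp [wt]
  have h := h3 u 0 0
  simpa [tric, h0, z2_add_self] using h

theorem z2_aux (a b c p q r s : ZMod 2) :
    b + c + p + (a + a + q) + 0 = b + (c + a + r + a + s) + p ↔ s = q + r := by
  have ha := z2_add_self a
  have hr := z2_add_self r
  constructor
  · intro h
    linear_combination -hr - h
  · intro h
    linear_combination -hr - h

theorem stmt11 {n : ℕ} (C : Submodule (ZMod 2) (Fin n → ZMod 2))
    (φ : C → C → ZMod 2) (hC : DoublyEven C) (hφ : IsFactorSet C φ) :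
    (∀ x y z : ZMod 2 × C,
      cmul φ (cmul φ y z) (cmul φ x x) = cmul φ y (cmul φ (cmul φ z x) x)) ↔ LWL φ := by
  have hz := factor_zero_right C φ hφ
  have hu : ∀ u : C, u + u = 0 := fun u => by
    ext i
    simp [z2_add_self]
  have key : ∀ x y z : ZMod 2 × C,
      cmul φ (cmul φ y z) (cmul φ x x) = cmul φ y (cmul φ (cmul φ z x) x) ↔
        φ (x.2 + z.2) x.2 = φ x.2 x.2 + φ z.2 x.2 := by
    rintro ⟨a, u⟩ ⟨b, v⟩ ⟨c, w⟩
    simp only [cmul, Prod.mk.injEq, hu, hz, add_assoc w u u, add_zero, and_true]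
    rw [add_comm u w, ← z2_aux a b c (φ v w) (φ u u) (φ w u) (φ (w + u) u)]
    simp only [add_zero]
  constructor
  · intro h u v
    exact (key (0, u) (0, 0) (0, v)).1 (h _ _ _)
  · intro h x y z
    exact (key x y z).2 (h _ _)
end

section
/- Let C be a doubly even binary linear code, φ a factor set on C, and L(φ) the associated code loop with multiplication ∗. L(φ) is a central loop — i.e., both identities (x∗x)∗(y∗z) = (x∗(x∗y))∗z and (y∗z)∗(x∗x) = y∗((z∗x)∗x) hold for all x, y, z ∈ L(φ) — if and only if φ is weakly linear. -/
theorem stmt12 {n : ℕ} (C : Submodule (ZMod 2) (Fin n → ZMod 2))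
    (φ : C → C → ZMod 2) (hC : DoublyEven C) (hφ : IsFactorSet C φ) :
    ((∀ x y z : ZMod 2 × C,
      cmul φ (cmul φ x x) (cmul φ y z) = cmul φ (cmul φ x (cmul φ x y)) z) ∧
     (∀ x y z : ZMod 2 × C,
      cmul φ (cmul φ y z) (cmul φ x x) = cmul φ y (cmul φ (cmul φ z x) x))) ↔
    (LWL φ ∧ RWL φ) := by
  obtain ⟨h1, -, h3⟩ := hφ
  have hself : ∀ u : C, u + u = 0 := fun u => by
    ext i
    exact CharTwo.add_self_eq_zero _
  have hss : ∀ u v : C, u + (u + v) = v := fun u v => by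
    rw [← add_assoc, hself, zero_add]
  have hss2 : ∀ u v : C, v + u + u = v := fun u v => by
    rw [add_assoc, hself, add_zero]
  have e2 : ∀ a : ZMod 2, a + a = 0 := by decide
  have h00 : φ 0 0 = 0 := by
    rw [h1]; simp [wt]
  have h0l : ∀ w, φ 0 w = 0 := fun w => by
    have := h3 0 0 w
    simpa [tric, h00, e2] using this
  have h0r : ∀ w, φ w 0 = 0 := fun w => by
    have := h3 w 0 0
    simpa [tric, h00, e2] using this
  have k1 : ∀ a b c p q r s : ZMod 2, a + a + p + (b + c + q) + 0 =
      a + (a + b + r) + s + c + q ↔ s = p + r := by decide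
  have k2 : ∀ a b c p q r s : ZMod 2, b + c + q + (a + a + p) + 0 =
      b + (c + a + r + a + s) + q ↔ s = p + r := by decide
  constructor
  · rintro ⟨hl, hr⟩
    constructor
    · intro u v
      have := congrArg Prod.fst (hr (0, u) (0, 0) (0, v))
      simp only [cmul, hself, hss2, h0r] at this
      rw [add_comm u v]
      exact (k2 _ _ _ _ _ _ _).1 this
    · intro u v
      have := congrArg Prod.fst (hl (0, u) (0, v) (0, 0))
      simp only [cmul, hself, hss, h0l] at this
      exact (k1 _ _ _ _ _ _ _).1 this
  · rintro ⟨hl, hr⟩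
    constructor
    · rintro ⟨a, u⟩ ⟨b, v⟩ ⟨c, w⟩
      simp only [cmul, hself, hss, h0l, zero_add, Prod.mk.injEq, and_true]
      exact (k1 _ _ _ _ _ _ _).2 (hr u v)
    · rintro ⟨a, u⟩ ⟨b, v⟩ ⟨c, w⟩
      simp only [cmul, hself, hss2, h0r, add_zero (_ : C), Prod.mk.injEq, and_true]
      have := hl u w
      rw [add_comm u w] at this
      exact (k2 _ _ _ _ _ _ _).2 this
end

section
/- Let C be a doubly even binary linear code, φ a factor set on C, and L(φ) the associated code loop with multiplication ∗. The identity y∗(x∗(x∗z)) = ((y∗x)∗x)∗z holds for all x, y, z ∈ L(φ) if and only if φ(v,u) + φ(u,w) + φ(v+u, u) + φ(u, u+w) = 0 for all u, v, w ∈ C. -/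
theorem stmt13 {n : ℕ} (C : Submodule (ZMod 2) (Fin n → ZMod 2))
    (φ : C → C → ZMod 2) (hC : DoublyEven C) (hφ : IsFactorSet C φ) :
    (∀ x y z : ZMod 2 × C,
      cmul φ y (cmul φ x (cmul φ x z)) = cmul φ (cmul φ (cmul φ y x) x) z) ↔
    (∀ u v w : C, φ v u + φ u w + φ (v + u) u + φ u (u + w) = 0) := by
  have huw : ∀ u w : C, u + (u + w) = w := by
    intro u w
    have h : u + u = 0 := by
      ext i
      exact CharTwo.add_self_eq_zero _
    rw [← add_assoc, h, zero_add]
  have hvu : ∀ v u : C, v + u + u = v := by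
    intro v u
    rw [add_comm, add_comm v u, huw]
  have key : ∀ a b c p q r s t : ZMod 2,
      (b + (a + (a + c + p) + q) + t = b + a + r + a + s + c + t) ↔
        r + p + s + q = 0 := by
    decide
  constructor
  · intro h u v w
    have h1 := congrArg Prod.fst (h (0, u) (0, v) (0, w))
    simp only [cmul, huw, hvu] at h1
    exact (key _ _ _ _ _ _ _ _).1 h1
  · rintro h ⟨a, u⟩ ⟨b, v⟩ ⟨c, w⟩
    simp only [cmul, huw, hvu]
    exact Prod.ext ((key _ _ _ _ _ _ _ _).2 (h u v w)) rfl
end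

section
/- Let C be a doubly even binary linear code, φ a factor set on C, and L(φ) the associated code loop with multiplication ∗. The extra-loop identity ((x∗y)∗z)∗x = x∗(y∗(z∗x)) holds for all x, y, z ∈ L(φ) if and only if φ(u,v) + φ(w,u) + φ(u+v, w) + φ(v+w, u) + φ(v, w+u) + φ(u, v+w) = 0 for all u, v, w ∈ C. -/
theorem stmt14 {n : ℕ} (C : Submodule (ZMod 2) (Fin n → ZMod 2))
    (φ : C → C → ZMod 2) (hC : DoublyEven C) (hφ : IsFactorSet C φ) :
    (∀ x y z : ZMod 2 × C,
      cmul φ (cmul φ (cmul φ x y) z) x = cmul φ x (cmul φ y (cmul φ z x))) ↔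
    (∀ u v w : C, φ u v + φ w u + φ (u + v) w + φ (v + w) u + φ v (w + u) + φ u (v + w) = 0) := by
  obtain ⟨-, -, h3⟩ := hφ
  have key : ∀ u t : C, φ u t + φ (u + t) u + φ t u + φ u (t + u) = 0 := by
    intro u t
    rw [h3 u t u]
    have e : tric (u : Fin n → ZMod 2) t u = dotc (u : Fin n → ZMod 2) t := by
      unfold tric dotc
      congr 1
      ext i
      simp only [Finset.mem_filter]
      tauto
    rw [e]
    exact (ZMod.natCast_eq_zero_iff _ _).2 (hC u t).2
  have two : ∀ a b : ZMod 2, a = b ↔ a + b = 0 := by decide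
  have dbl : ∀ a : ZMod 2, a + a = 0 := by decide
  have main : ∀ (a b c : ZMod 2) (u v w : C),
      cmul φ (cmul φ (cmul φ (a, u) (b, v)) (c, w)) (a, u)
        = cmul φ (a, u) (cmul φ (b, v) (cmul φ (c, w) (a, u))) ↔
      φ u v + φ w u + φ (u + v) w + φ (v + w) u + φ v (w + u) + φ u (v + w) = 0 := by
    intro a b c u v w
    have k := key u (v + w)
    have e1 : u + v + w = u + (v + w) := add_assoc _ _ _
    have e2 : v + (w + u) = v + w + u := (add_assoc _ _ _).symm
    have e3 : u + (v + w) + u = u + (v + w + u) := add_assoc _ _ _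
    simp only [cmul, Prod.mk.injEq, e1, e2, e3, and_true]
    rw [two]
    have : (a + b + φ u v + c + φ (u + v) w + a + φ (u + (v + w)) u +
        (a + (b + (c + a + φ w u) + φ v (w + u)) + φ u (v + w + u)))
        = φ u v + φ w u + φ (u + v) w + φ (v + w) u + φ v (w + u) + φ u (v + w) := by
      linear_combination k + 2 * dbl a + dbl b + dbl c - dbl (φ u (v + w)) - dbl (φ (v + w) u)
    rw [this]
  constructor
  · intro h u v w
    exact (main 0 0 0 u v w).1 (h _ _ _)
  · rintro h ⟨a, u⟩ ⟨b, v⟩ ⟨c, w⟩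
    exact (main a b c u v w).2 (h u v w)
end

section
/- Let C be a doubly even binary linear code, φ a factor set on C, and L(φ) the associated code loop with multiplication ∗. The extra-loop identity (x∗y)∗(x∗z) = x∗((y∗x)∗z) holds for all x, y, z ∈ L(φ) if and only if φ(u,u) + φ(u,v) + φ(v,u) + φ(u,w) + φ(v+u, w) + φ(u, v+w) + φ(u+v, u+w) = 0 for all u, v, w ∈ C. -/
theorem rwl_of_factorSet {n : ℕ} (C : Submodule (ZMod 2) (Fin n → ZMod 2))
    (φ : C → C → ZMod 2) (hC : DoublyEven C) (hφ : IsFactorSet C φ) (u x : C) :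
    φ u (u + x) = φ u u + φ u x := by
  obtain ⟨h1, -, h3⟩ := hφ
  have h00 : φ 0 0 = 0 := by
    rw [h1]; simp [wt]
  have h0 : φ 0 x = 0 := by
    have h := h3 0 0 x
    simp only [add_zero, zero_add, h00] at h
    have ht : tric ((0 : C) : Fin n → ZMod 2) ((0 : C) : Fin n → ZMod 2) (x : Fin n → ZMod 2)
        = 0 := by simp [tric]
    rw [ht] at h
    generalize φ 0 x = a at h
    revert a
    decide
  have h := h3 u u x
  have huu : u + u = 0 := Subtype.ext (funext fun i => CharTwo.add_self_eq_zero _)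
  have ht : tric (u : Fin n → ZMod 2) (u : Fin n → ZMod 2) (x : Fin n → ZMod 2)
      = dotc (u : Fin n → ZMod 2) (x : Fin n → ZMod 2) := by
    simp [tric, dotc]
  rw [huu, h0, ht, (ZMod.natCast_eq_zero_iff _ 2).2 (hC u x).2] at h
  generalize φ u u = a at *
  generalize φ u x = b at *
  generalize φ u (u + x) = c at *
  clear * - h
  revert a b c
  decide

theorem stmt15 {n : ℕ} (C : Submodule (ZMod 2) (Fin n → ZMod 2))
    (φ : C → C → ZMod 2) (hC : DoublyEven C) (hφ : IsFactorSet C φ) :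
    (∀ x y z : ZMod 2 × C,
      cmul φ (cmul φ x y) (cmul φ x z) = cmul φ x (cmul φ (cmul φ y x) z)) ↔
    (∀ u v w : C, φ u u + φ u v + φ v u + φ u w + φ (v + u) w + φ u (v + w) +
      φ (u + v) (u + w) = 0) := by
  have key : ∀ u v w : C, φ u (v + u + w) = φ u u + φ u (v + w) := fun u v w => by
    rw [← rwl_of_factorSet C φ hC hφ]
    congr 1
    abel
  have ar : ∀ a b c p q r s t m k : ZMod 2,
      (a + b + p + (a + c + q) + r = a + (b + a + s + c + t) + (m + k)) ↔
      m + p + s + q + t + k + r = 0 := by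
    intro a b c p q r s t m k
    have h2 : ∀ y : ZMod 2, y + y = 0 := CharTwo.add_self_eq_zero
    constructor
    · intro h
      linear_combination h + h2 m + h2 s + h2 t + h2 k
    · intro h
      linear_combination h - h2 m - h2 s - h2 t - h2 k
  constructor
  · intro h u v w
    have h' := congrArg Prod.fst (h (0, u) (0, v) (0, w))
    simp only [cmul] at h'
    rw [key] at h'
    exact (ar _ _ _ _ _ _ _ _ _ _).1 h'
  · rintro h ⟨a, u⟩ ⟨b, v⟩ ⟨c, w⟩
    simp only [cmul]
    refine Prod.ext ?_ ?_
    · simp only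
      rw [key]
      exact (ar _ _ _ _ _ _ _ _ _ _).2 (h u v w)
    · simp only
      abel
end

section
/- Let C be a doubly even binary linear code, φ a factor set on C, and L(φ) the associated code loop with multiplication ∗. The extra-loop identity (y∗x)∗(z∗x) = (y∗(x∗z))∗x holds for all x, y, z ∈ L(φ) if and only if φ(u,u) + φ(v,u) + φ(u,w) + φ(w,u) + φ(v, u+w) + φ(v+w, u) + φ(v+u, w+u) = 0 for all u, v, w ∈ C. -/
theorem lwl_of_factorSet {n : ℕ} (C : Submodule (ZMod 2) (Fin n → ZMod 2))
    (φ : C → C → ZMod 2) (hC : DoublyEven C) (hφ : IsFactorSet C φ) (u v : C) :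
    φ (v + u) u = φ u u + φ v u := by
  obtain ⟨h1, _, h3⟩ := hφ
  have h00 : φ 0 0 = 0 := by
    rw [h1]; simp [wt]
  have hv0 : φ v 0 = 0 := by
    have h := h3 v 0 0
    have ht : tric (v : Fin n → ZMod 2) ((0 : C) : Fin n → ZMod 2)
        ((0 : C) : Fin n → ZMod 2) = 0 := by simp [tric]
    rw [ht, add_zero, add_zero, h00, CharTwo.add_self_eq_zero] at h
    simpa using h
  have h := h3 v u u
  have ht : tric (v : Fin n → ZMod 2) (u : Fin n → ZMod 2) (u : Fin n → ZMod 2)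
      = dotc (v : Fin n → ZMod 2) (u : Fin n → ZMod 2) := by simp [tric, dotc]
  have huu : u + u = 0 := by
    ext i
    simpa using CharTwo.add_self_eq_zero ((u : Fin n → ZMod 2) i)
  rw [ht, (ZMod.natCast_eq_zero_iff _ 2).2 (hC v u).2, huu, hv0] at h
  generalize φ (v + u) u = a at *
  generalize φ u u = b at *
  generalize φ v u = c at *
  clear * - h
  revert a b c
  decide

theorem zmod_two_aux (a b c p q r s t x y : ZMod 2) :
    (b + a + p + (c + a + q) + r = b + (a + c + s) + t + a + (x + y)) ↔
      (x + p + s + q + t + y + r = 0) := by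
  have h2 : (2 : ZMod 2) = 0 := rfl
  constructor <;> intro h
  · linear_combination h + (x + s + t + y) * h2
  · linear_combination h - (x + s + t + y) * h2

theorem stmt16 {n : ℕ} (C : Submodule (ZMod 2) (Fin n → ZMod 2))
    (φ : C → C → ZMod 2) (hC : DoublyEven C) (hφ : IsFactorSet C φ) :
    (∀ x y z : ZMod 2 × C,
      cmul φ (cmul φ y x) (cmul φ z x) = cmul φ (cmul φ y (cmul φ x z)) x) ↔
    (∀ u v w : C, φ u u + φ v u + φ u w + φ w u + φ v (u + w) + φ (v + w) u +
      φ (v + u) (w + u) = 0) := by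
  have key : ∀ (a b c : ZMod 2) (u v w : C),
      (cmul φ (cmul φ (b, v) (a, u)) (cmul φ (c, w) (a, u)) =
        cmul φ (cmul φ (b, v) (cmul φ (a, u) (c, w))) (a, u)) ↔
      (φ u u + φ v u + φ u w + φ w u + φ v (u + w) + φ (v + w) u +
        φ (v + u) (w + u) = 0) := by
    intro a b c u v w
    have e : v + (u + w) = (v + w) + u := by abel
    have e2 : v + u + (w + u) = v + (u + w) + u := by abel
    simp only [cmul, Prod.mk.injEq, e2, and_true]
    rw [e, lwl_of_factorSet C φ hC hφ u (v + w)]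
    exact zmod_two_aux _ _ _ _ _ _ _ _ _ _
  constructor
  · intro h u v w
    exact (key 0 0 0 u v w).1 (h _ _ _)
  · rintro h ⟨a, u⟩ ⟨b, v⟩ ⟨c, w⟩
    exact (key a b c u v w).2 (h u v w)
end

section
/- Let C be a doubly even binary linear code, φ a factor set on C, and L(φ) the associated code loop with multiplication ∗. L(φ) is an extra loop — i.e., the identity ((x∗y)∗z)∗x = x∗(y∗(z∗x)) holds for all x, y, z ∈ L(φ) — if and only if φ is weakly linear. -/
/-- Both weak linearity conditions hold for every factor set on a doubly even code. -/
theorem factorSet_weaklyLinear {n : ℕ} (C : Submodule (ZMod 2) (Fin n → ZMod 2))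
    (φ : C → C → ZMod 2) (hC : DoublyEven C) (hφ : IsFactorSet C φ) : LWL φ ∧ RWL φ := by
  obtain ⟨h1, -, h3⟩ := hφ
  have h00 : φ 0 0 = 0 := by simp [h1, wt]
  have hz : ∀ u w : C, φ u 0 + φ 0 w = 0 := by
    intro u w
    have h := h3 u 0 w
    have ht : tric (u : Fin n → ZMod 2) ((0 : C) : Fin n → ZMod 2) w = 0 := by simp [tric]
    rw [ht, add_zero, zero_add, Nat.cast_zero] at h
    have := CharTwo.add_self_eq_zero (φ u w)
    linear_combination h - this
  have hl : ∀ w, φ 0 w = 0 := fun w => by simpa [h00] using hz 0 w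
  have hr : ∀ w, φ w 0 = 0 := fun w => by simpa [h00] using hz w 0
  have hd : ∀ u v : C, ((dotc (u : Fin n → ZMod 2) v : ℕ) : ZMod 2) = 0 := fun u v =>
    (ZMod.natCast_eq_zero_iff _ _).2 (hC u v).2
  have huu : ∀ u : C, u + u = 0 := fun u => by
    ext i
    exact CharTwo.add_self_eq_zero _
  constructor
  · intro u v
    have h := h3 v u u
    have ht : tric (v : Fin n → ZMod 2) u u = dotc (v : Fin n → ZMod 2) u := by
      simp [tric, dotc]
    rw [ht, hd, huu, hr, add_comm v u] at h
    have e1 := CharTwo.add_self_eq_zero (φ v u)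
    have e2 := CharTwo.add_self_eq_zero (φ u u)
    linear_combination h - e1 - e2
  · intro u v
    have h := h3 u u v
    have ht : tric (u : Fin n → ZMod 2) u v = dotc (u : Fin n → ZMod 2) v := by
      simp [tric, dotc]
    rw [ht, hd, huu, hl] at h
    have e1 := CharTwo.add_self_eq_zero (φ u v)
    have e2 := CharTwo.add_self_eq_zero (φ u u)
    linear_combination h - e1 - e2

theorem stmt17 {n : ℕ} (C : Submodule (ZMod 2) (Fin n → ZMod 2))
    (φ : C → C → ZMod 2) (hC : DoublyEven C) (hφ : IsFactorSet C φ) :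
    (∀ x y z : ZMod 2 × C,
      cmul φ (cmul φ (cmul φ x y) z) x = cmul φ x (cmul φ y (cmul φ z x))) ↔
    (LWL φ ∧ RWL φ) := by
  refine ⟨fun _ => factorSet_weaklyLinear C φ hC hφ, ?_⟩
  rintro ⟨hL, hR⟩ ⟨a, x⟩ ⟨b, y⟩ ⟨c, z⟩
  obtain ⟨-, -, h3⟩ := hφ
  have A := h3 x y z
  have B := h3 y z x
  have ht : tric (x : Fin n → ZMod 2) y z = tric (y : Fin n → ZMod 2) z x := by
    unfold tric
    congr 1
    ext i
    simp only [Finset.mem_filter]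
    tauto
  rw [ht] at A
  have l := hL x (y + z)
  have r := hR x (y + z)
  simp only [cmul, Prod.mk.injEq]
  constructor
  · have e1 : y + (z + x) = x + (y + z) := by abel
    rw [e1, add_assoc x y z]
    have two : (2 : ZMod 2) = 0 := by decide
    linear_combination A - B + l - r + (φ (y + z) x - φ x (y + z)) * two
  · abel
end

section
/- Let C be a doubly even binary linear code and φ a factor set on C. Then the code loop L(φ) is an extra loop: the identity ((x∗y)∗z)∗x = x∗(y∗(z∗x)) holds for all x, y, z ∈ L(φ). -/
theorem tric_cast {n : ℕ} (u v w : Fin n → ZMod 2) :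
    ((tric u v w : ℕ) : ZMod 2) = ∑ i, u i * v i * w i := by
  unfold tric
  rw [Finset.card_filter]
  push_cast
  refine Finset.sum_congr rfl fun i _ => ?_
  generalize u i = a
  generalize v i = b
  generalize w i = c
  revert a b c
  decide

theorem dotc_cast {n : ℕ} (u v : Fin n → ZMod 2) :
    ((dotc u v : ℕ) : ZMod 2) = ∑ i, u i * v i := by
  unfold dotc
  rw [Finset.card_filter]
  push_cast
  refine Finset.sum_congr rfl fun i _ => ?_
  generalize u i = a
  generalize v i = b
  revert a b
  decide

theorem tric_sum {n : ℕ} (u v w : Fin n → ZMod 2) :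
    ((tric (u + v) w u : ℕ) : ZMod 2) + ((tric u v (w + u) : ℕ) : ZMod 2)
      = ((dotc u w : ℕ) : ZMod 2) + ((dotc u v : ℕ) : ZMod 2) := by
  simp only [tric_cast, dotc_cast, ← Finset.sum_add_distrib, Pi.add_apply]
  refine Finset.sum_congr rfl fun i _ => ?_
  generalize u i = a
  generalize v i = b
  generalize w i = c
  revert a b c
  decide

theorem stmt18 {n : ℕ} (C : Submodule (ZMod 2) (Fin n → ZMod 2))
    (φ : C → C → ZMod 2) (hC : DoublyEven C) (hφ : IsFactorSet C φ) :
    ∀ x y z : ZMod 2 × C,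
      cmul φ (cmul φ (cmul φ x y) z) x = cmul φ x (cmul φ y (cmul φ z x)) := by
  rintro ⟨a, u⟩ ⟨b, v⟩ ⟨c, w⟩
  obtain ⟨-, -, h⟩ := hφ
  have h1 := h (u + v) w u
  have h2 := h u v (w + u)
  have e1 : ((dotc (u : Fin n → ZMod 2) w : ℕ) : ZMod 2) = 0 :=
    (ZMod.natCast_eq_zero_iff _ _).2 (hC u w).2
  have e2 : ((dotc (u : Fin n → ZMod 2) v : ℕ) : ZMod 2) = 0 :=
    (ZMod.natCast_eq_zero_iff _ _).2 (hC u v).2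
  have h3 := tric_sum (u : Fin n → ZMod 2) v w
  rw [e1, e2] at h3
  rw [Submodule.coe_add] at h1 h2
  rw [← h1, ← h2] at h3
  have h4 : (2 : ZMod 2) = 0 := rfl
  unfold cmul
  refine Prod.ext ?_ ?_
  · simp only
    linear_combination h3 - (φ w u + φ v (w + u) + φ (u + v) (w + u) + φ u (v + (w + u))) * h4
  · simp only
    abel
end

section
/- Let C be a doubly even binary linear code and φ a factor set on C. Then φ is weakly linear: for all u, v ∈ C, φ(u+v, u) = φ(u,u) + φ(v,u) and φ(u, u+v) = φ(u,u) + φ(u,v). -/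
theorem stmt19 {n : ℕ} (C : Submodule (ZMod 2) (Fin n → ZMod 2))
    (φ : C → C → ZMod 2) (hC : DoublyEven C) (hφ : IsFactorSet C φ) :
    ∀ u v : C, φ (u + v) u = φ u u + φ v u ∧ φ u (u + v) = φ u u + φ u v := by
  obtain ⟨h1, h2, h3⟩ := hφ
  have two : ∀ x : ZMod 2, x + x = 0 := by decide
  have dbl : ∀ u : C, u + u = 0 := fun u => by
    ext i
    exact two _
  have ev : ∀ u v : C, ((dotc (u : Fin n → ZMod 2) (v : Fin n → ZMod 2) : ℕ) : ZMod 2) = 0 :=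
    fun u v => (ZMod.natCast_eq_zero_iff _ 2).2 (hC u v).2
  have t1 : ∀ u v : Fin n → ZMod 2, tric u u v = dotc u v := fun u v => by
    simp [tric, dotc]
  have t2 : ∀ u v : Fin n → ZMod 2, tric v u u = dotc v u := fun u v => by
    simp [tric, dotc]
  have z00 : φ 0 0 = 0 := by
    rw [h1]; simp [wt]
  have z0 : ∀ v : C, φ 0 v = 0 := fun v => by
    have h := h3 0 0 v
    rw [t1, ev, add_zero, zero_add, z00, zero_add, two, zero_add] at h
    exact h
  have z1 : ∀ v : C, φ v 0 = 0 := fun v => by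
    have h := h2 v 0
    rw [z0, add_zero] at h
    rw [h]; simp [dotc]
  have key : ∀ a b c : ZMod 2, a + b + c = 0 → b = c + a := by decide
  have key2 : ∀ a b c : ZMod 2, a + b + c = 0 → c = a + b := by decide
  intro u v
  constructor
  · have h := h3 v u u
    rw [t2, ev, dbl, z1, add_zero, add_comm v u] at h
    exact key _ _ _ h
  · have h := h3 u u v
    rw [t1, ev, dbl, z0, add_zero] at h
    exact key2 _ _ _ h
end
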